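/- Let N be a topological manifold, Ω ⊆ N open, and S a topological manifold with dim(S) = dim(N). Let ψ : Ω × S → N be continuous such that for each p ∈ Ω the map ψ_p := ψ(p,·) : S → N is injective, and suppose there exists s₀ ∈ S with ψ_p(s₀) = p for all p ∈ Ω. Then for every p₀ ∈ Ω there is an open set U ⊆ Ω containing p₀ such that ψ_q(S) ⊇ U for all q ∈ U. -/

import Mathlib

open Set Metric MeasureTheory Module Topology
open scoped NNReal

section Determinant

variable {E : Type*} [NormedAddCommGroup E] [NormedSpace ℝ E] [FiniteDimensional ℝ E]

/-- The determinant of `1 + L` is a fixed affine combination of the determinants of `1 + v i • L`,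
because `t ↦ det (1 + t • L)` is a polynomial of degree at most the dimension. -/
theorem ContinuousLinearMap.exists_det_one_add_eq_sum (v : ℕ → ℝ) (hv : Function.Injective v) :
    ∃ c : ℕ → ℝ, ∀ L : E →L[ℝ] E,
      (1 + L).det = ∑ i ∈ Finset.range (finrank ℝ E + 1), c i * (1 + v i • L).det := by
  refine ⟨fun i => (Lagrange.basis (Finset.range (finrank ℝ E + 1)) v i).eval 1, fun L => ?_⟩
  let b := finBasis ℝ E
  let M := LinearMap.toMatrix b b (L : E →ₗ[ℝ] E)
  let p : Polynomial ℝ := (((Polynomial.X : Polynomial ℝ) • M.map Polynomial.C +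
    (1 : Matrix (Fin (finrank ℝ E)) (Fin (finrank ℝ E)) ℝ).map Polynomial.C :
      Matrix _ _ (Polynomial ℝ))).det
  have hp (t : ℝ) : p.eval t = (1 + t • L).det := by
    have h1 : (1 + t • L).det = (LinearMap.toMatrix b b ((1 + t • L : E →L[ℝ] E) : E →ₗ[ℝ] E)).det :=
      (LinearMap.det_toMatrix b _).symm
    have h2 : LinearMap.toMatrix b b ((1 + t • L : E →L[ℝ] E) : E →ₗ[ℝ] E) = 1 + t • M := by
      have : ((1 + t • L : E →L[ℝ] E) : E →ₗ[ℝ] E) = 1 + t • (L : E →ₗ[ℝ] E) := by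
        ext x; simp
      rw [this, map_add, map_smul, LinearMap.toMatrix_one]
    rw [h1, h2, ← Polynomial.coe_evalRingHom, RingHom.map_det]
    congr 1
    ext i j
    by_cases hij : i = j <;> simp [hij, mul_comm t, add_comm]
  have hdeg : p.degree < (Finset.range (finrank ℝ E + 1)).card := by
    have := Polynomial.natDegree_det_X_add_C_le M 1
    rw [Fintype.card_fin] at this
    rw [Finset.card_range]
    exact lt_of_le_of_lt (Polynomial.degree_le_of_natDegree_le this)
      (by exact_mod_cast Nat.lt_succ_self _)
  have h := congrArg (Polynomial.eval 1) (Lagrange.eq_interpolate hv.injOn hdeg)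
  rw [hp, one_smul, Lagrange.interpolate_apply, Polynomial.eval_finsetSum] at h
  rw [h]
  refine Finset.sum_congr rfl fun i _ => ?_
  rw [Polynomial.eval_mul, Polynomial.eval_C, hp, mul_comm]

theorem ContinuousLinearMap.det_one_add_pos {L : E →L[ℝ] E} (hL : ‖L‖ < 1) : 0 < (1 + L).det := by
  have : CompleteSpace E := FiniteDimensional.complete ℝ E
  have hne : ∀ s ∈ Icc (0 : ℝ) 1, (1 + s • L).det ≠ 0 := by
    intro s hs
    have hlt : ‖-(s • L)‖ < 1 := by
      rw [norm_neg, norm_smul, Real.norm_of_nonneg hs.1]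
      exact lt_of_le_of_lt (mul_le_of_le_one_left (norm_nonneg _) hs.2) hL
    have hu : IsUnit (1 + s • L) := by
      simpa using isUnit_one_sub_of_norm_lt_one hlt
    have := (hu.map (ContinuousLinearMap.toLinearMapRingHom : (E →L[ℝ] E) →+* (E →ₗ[ℝ] E))).map
      (LinearMap.det : (E →ₗ[ℝ] E) →* ℝ)
    exact this.ne_zero
  have hcont : ContinuousOn (fun s : ℝ => (1 + s • L).det) (Icc 0 1) :=
    (ContinuousLinearMap.continuous_det.comp (by fun_prop)).continuousOn
  by_contra! hneg
  obtain ⟨s, hs, hs0⟩ := intermediate_value_Icc' zero_le_one hcont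
    ⟨by simpa only [one_smul] using hneg, by simp [ContinuousLinearMap.det]⟩
  exact hne s hs hs0

end Determinant

/-- A Lipschitz function on a closed ball vanishing on the sphere remains Lipschitz when extended
by zero. -/
theorem LipschitzOnWith.indicator_closedBall {E F : Type*} [NormedAddCommGroup E] [NormedSpace ℝ E]
    [NormedAddCommGroup F] {g : E → F} {C : ℝ≥0} {R : ℝ}
    (hg : LipschitzOnWith C g (closedBall 0 R)) (h0 : ∀ x, ‖x‖ = R → g x = 0) :
    LipschitzWith C ((closedBall 0 R).indicator g) := by
  have key : ∀ x ∈ closedBall (0 : E) R, ∀ y ∉ closedBall (0 : E) R, ‖g x‖ ≤ C * ‖x - y‖ := by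
    intro x hx y hy
    have hx' : ‖x‖ ≤ R := by simpa using hx
    have hy' : R ≤ ‖y‖ := by simpa using le_of_lt (by simpa using hy)
    obtain ⟨z, hz, hzR⟩ := (convex_segment x y).isPreconnected.intermediate_value
      (left_mem_segment ℝ x y) (right_mem_segment ℝ x y) continuous_norm.continuousOn ⟨hx', hy'⟩
    have hz' : z ∈ closedBall (0 : E) R := by simp [hzR]
    calc ‖g x‖ = ‖g x - g z‖ := by rw [h0 z hzR, sub_zero]
      _ ≤ C * ‖x - z‖ := hg.norm_sub_le hx hz'
      _ ≤ C * ‖x - y‖ := by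
        gcongr
        rw [norm_sub_rev x z, norm_sub_rev x y]
        exact norm_sub_le_of_mem_segment hz
  refine LipschitzWith.of_dist_le_mul fun x y => ?_
  rw [dist_eq_norm, dist_eq_norm]
  by_cases hx : x ∈ closedBall (0 : E) R <;> by_cases hy : y ∈ closedBall (0 : E) R
  · simpa only [indicator_of_mem hx, indicator_of_mem hy] using hg.norm_sub_le hx hy
  · simpa only [indicator_of_mem hx, indicator_of_notMem hy, sub_zero] using key x hx y hy
  · simpa only [indicator_of_mem hy, indicator_of_notMem hx, zero_sub, norm_neg, norm_sub_rev x y]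
      using key y hy x hx
  · simp only [indicator_of_notMem hx, indicator_of_notMem hy, sub_zero, norm_zero]
    positivity

theorem LipschitzWith.bijective_id_add {E : Type*} [NormedAddCommGroup E] [CompleteSpace E]
    {g : E → E} {K : ℝ≥0} (hg : LipschitzWith K g) (hK : K < 1) :
    Function.Bijective fun x => x + g x := by
  have hc (y : E) : ContractingWith K fun x => y - g x :=
    ⟨hK, LipschitzWith.of_dist_le_mul fun a b => by
      rw [dist_sub_left]; exact hg.dist_le_mul a b⟩
  constructor
  · intro a b hab
    have ha : Function.IsFixedPt (fun x => (a + g a) - g x) a := add_sub_cancel_right _ _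
    have hb : Function.IsFixedPt (fun x => (a + g a) - g x) b := by
      change a + g a - g b = b
      rw [show a + g a = b + g b from hab, add_sub_cancel_right]
    exact (hc _).fixedPoint_unique' ha hb
  · intro y
    have h : y - g _ = _ := (hc y).fixedPoint_isFixedPt
    exact ⟨ContractingWith.fixedPoint _ (hc y), by
      change ContractingWith.fixedPoint _ (hc y) + g _ = y
      exact (eq_sub_iff_add_eq.1 h.symm)⟩

/-- There is no smooth retraction of a ball onto its boundary sphere. -/
theorem not_forall_norm_eq_of_eq_id_on_sphere {E : Type*} [NormedAddCommGroup E]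
    [InnerProductSpace ℝ E] [FiniteDimensional ℝ E] {f : E → E} {R : ℝ} (hR : 0 < R)
    (hf : ContDiff ℝ 1 f) (hid : ∀ x, ‖x‖ = R → f x = x) : ¬ ∀ x, ‖f x‖ = R := by
  intro hnorm
  borelize E
  have : CompleteSpace E := FiniteDimensional.complete ℝ E
  let μ : Measure E := volume
  set B := closedBall (0 : E) R with hB
  have hBc : IsCompact B := isCompact_closedBall 0 R
  let g : E → E := fun x => f x - x
  have hgd : ContDiff ℝ 1 g := hf.sub contDiff_id
  have hdc : Continuous (fderiv ℝ g) := hgd.continuous_fderiv one_ne_zero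
  have hgdiff : Differentiable ℝ g := hgd.differentiable one_ne_zero
  obtain ⟨C, hC⟩ : ∃ C : ℝ≥0, ∀ x ∈ B, ‖fderiv ℝ g x‖₊ ≤ C := by
    obtain ⟨C, hC⟩ := (hBc.image hdc.nnnorm).bddAbove
    exact ⟨C, fun x hx => hC (mem_image_of_mem _ hx)⟩
  have hlip : LipschitzOnWith C g B :=
    (convex_closedBall 0 R).lipschitzOnWith_of_nnnorm_fderiv_le (fun x _ => hgdiff x) hC
  have hlip' : LipschitzWith C (B.indicator g) :=
    hlip.indicator_closedBall fun x hx => by simp [g, hid x hx]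
  have small : ∀ t : ℝ, 0 < t → t * C < 1 →
      ∫ x in B, (1 + t • fderiv ℝ g x).det ∂μ = μ.real B := by
    intro t ht htC
    let T : ℝ≥0 := ⟨t, ht.le⟩
    have hTC : T * C < 1 := by exact_mod_cast htC
    have hbij : Function.Bijective fun x => x + t • B.indicator g x := by
      refine LipschitzWith.bijective_id_add (K := T * C) ?_ hTC
      refine LipschitzWith.of_dist_le_mul fun x y => ?_
      rw [dist_smul₀, Real.norm_of_nonneg ht.le]
      change t * _ ≤ t * C * _
      rw [mul_assoc]
      gcongr
      exact hlip'.dist_le_mul x y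
    have heq : EqOn (fun x => x + t • B.indicator g x) (fun x => x + t • g x) B := fun x hx => by
      simp only [indicator_of_mem hx]
    have hinj : InjOn (fun x => x + t • g x) B := heq.injOn_iff.1 hbij.1.injOn
    have himg : (fun x => x + t • g x) '' B = B := by
      rw [← heq.image_eq]
      have hcompl : (fun x => x + t • B.indicator g x) '' Bᶜ = Bᶜ := by
        rw [EqOn.image_eq (f₂ := id) fun x hx => by simp [indicator_of_notMem hx], image_id]
      rw [image_compl_eq hbij] at hcompl
      exact compl_injective hcompl
    have hder : ∀ x ∈ B, HasFDerivWithinAt (fun x => x + t • g x) (1 + t • fderiv ℝ g x) B x :=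
      fun x _ => ((hasFDerivAt_id x).add
        ((hgdiff x).hasFDerivAt.const_smul t)).hasFDerivWithinAt
    have h := integral_image_eq_integral_abs_det_fderiv_smul μ isClosed_closedBall.measurableSet
      hder hinj (fun _ => (1 : ℝ))
    rw [himg] at h
    simp only [smul_eq_mul, mul_one, integral_const, MeasurableSet.univ, measureReal_restrict_apply,
      univ_inter] at h
    rw [h]
    refine setIntegral_congr_fun isClosed_closedBall.measurableSet fun x hx => ?_
    refine (abs_of_pos (ContinuousLinearMap.det_one_add_pos ?_)).symm
    rw [norm_smul, Real.norm_of_nonneg ht.le]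
    exact lt_of_le_of_lt (by gcongr; exact_mod_cast hC x hx) htC
  let v : ℕ → ℝ := fun i => 1 / ((C + 1) * (i + 1))
  have hvpos (i : ℕ) : 0 < v i := by positivity
  have hvC (i : ℕ) : v i * C < 1 := by
    have : (0 : ℝ) ≤ C := C.2
    have hi : (0 : ℝ) ≤ i := i.cast_nonneg
    rw [one_div_mul_eq_div, div_lt_one (by positivity)]
    nlinarith
  have hvinj : Function.Injective v := by
    intro i j hij
    have : ((C : ℝ) + 1) ≠ 0 := by positivity
    simpa [v, this] using hij
  obtain ⟨c, hc⟩ := ContinuousLinearMap.exists_det_one_add_eq_sum (E := E) v hvinj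
  have hdet0 (x : E) : (1 + fderiv ℝ g x).det = 0 := by
    have h1 : 1 + fderiv ℝ g x = fderiv ℝ f x := by
      have : fderiv ℝ g x = fderiv ℝ f x - 1 :=
        (((hf.differentiable one_ne_zero x).hasFDerivAt).sub (hasFDerivAt_id x)).fderiv
      rw [this, add_sub_cancel]
    rw [h1]
    by_contra hne
    obtain ⟨w, hw⟩ := ((fderiv ℝ f x).toContinuousLinearEquivOfDetNeZero hne).surjective (f x)
    have hw' : fderiv ℝ f x w = f x := hw
    have hd := ((hf.differentiable one_ne_zero x).hasFDerivAt).norm_sq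
    have hconst : (fun x => ‖f x‖ ^ 2) = fun _ => R ^ 2 := by ext; rw [hnorm]
    rw [hconst] at hd
    have := congrArg (fun L => L w) (hd.unique (hasFDerivAt_const (R ^ 2) x))
    have h2 : 2 * inner ℝ (f x) (fderiv ℝ f x w) = 0 := by simpa using this
    rw [hw', real_inner_self_eq_norm_sq, hnorm] at h2
    nlinarith [pow_pos hR 2]
  have hint (t : ℝ) : IntegrableOn (fun x => (1 + t • fderiv ℝ g x).det) B μ :=
    (ContinuousLinearMap.continuous_det.comp
      (by fun_prop : Continuous fun x => 1 + t • fderiv ℝ g x)).continuousOn.integrableOn_compact hBc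
  have hzero : (0 : ℝ) = ∑ i ∈ Finset.range (finrank ℝ E + 1), c i * μ.real B := by
    calc (0 : ℝ) = ∫ x in B, (1 + fderiv ℝ g x).det ∂μ := by simp only [hdet0, integral_zero]
      _ = _ := by
        rw [integral_congr_ae (.of_forall fun x => hc (fderiv ℝ g x)),
          integral_finsetSum _ fun i _ => (hint (v i)).const_mul _]
        refine Finset.sum_congr rfl fun i _ => ?_
        rw [integral_const_mul, small _ (hvpos i) (hvC i)]
  have hsum : ∑ i ∈ Finset.range (finrank ℝ E + 1), c i = 1 := by
    have h1 : (1 : E →L[ℝ] E).det = 1 := LinearMap.det_id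
    have := hc 0
    simp only [smul_zero, add_zero, h1, mul_one] at this
    exact this.symm
  rw [← Finset.sum_mul, hsum, one_mul] at hzero
  have hpos : 0 < μ.real B :=
    ENNReal.toReal_pos (measure_closedBall_pos μ 0 hR).ne' hBc.measure_lt_top.ne
  exact hpos.ne hzero

section InvarianceOfDomain

variable {E : Type*} [NormedAddCommGroup E] [InnerProductSpace ℝ E] [FiniteDimensional ℝ E]

/-- A continuous self-map of a Euclidean space which is the identity far away has a zero. -/
theorem Continuous.exists_eq_zero_of_eq_id_far {h : E → E} {R : ℝ} (hR : 0 < R)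
    (hc : Continuous h) (hid : ∀ x, R ≤ ‖x‖ → h x = x) : ∃ x, h x = 0 := by
  by_contra! hne
  have hS : IsClosed {x : E | 2 * R ≤ ‖x‖} := isClosed_le continuous_const continuous_norm
  have hU : {x : E | R < ‖x‖} ∈ 𝓝ˢ {x : E | 2 * R ≤ ‖x‖} :=
    (isOpen_lt continuous_const continuous_norm).mem_nhdsSet.2 fun x (hx : 2 * R ≤ ‖x‖) =>
      show R < ‖x‖ by linarith
  obtain ⟨k, hk, hkh, hkS, -⟩ := hc.exists_contDiff_approx_and_eqOn 1 hc.norm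
    (fun x => norm_pos_iff.2 (hne x)) hS hU
    (contDiff_id.contDiffOn.congr fun x hx => hid x (le_of_lt hx))
  have hk0 (x : E) : k x ≠ 0 := fun h0 => by simpa [h0] using hkh x
  have hf : ContDiff ℝ 1 fun x => (2 * R * ‖k x‖⁻¹) • k x :=
    (contDiff_const.mul ((hk.norm ℝ hk0).inv fun x => norm_ne_zero_iff.2 (hk0 x))).smul hk
  refine not_forall_norm_eq_of_eq_id_on_sphere (by positivity : 0 < 2 * R) hf (fun x hx => ?_)
    fun x => ?_
  · have hkx : k x = x := (hkS hx.ge).trans (hid x (by linarith))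
    simp only [hkx, hx]
    rw [mul_inv_cancel₀ (by positivity), one_smul]
  · have : ‖k x‖ ≠ 0 := norm_ne_zero_iff.2 (hk0 x)
    rw [norm_smul, Real.norm_of_nonneg (by positivity), mul_assoc, inv_mul_cancel₀ this, mul_one]

/-- A continuous map on the closed unit ball at distance at most `1` from the identity has a
zero. -/
theorem ContinuousOn.exists_eq_zero_of_norm_sub_le_one {h : E → E}
    (hc : ContinuousOn h (closedBall 0 1)) (hh : ∀ x ∈ closedBall (0 : E) 1, ‖h x - x‖ ≤ 1) :
    ∃ x ∈ closedBall (0 : E) 1, h x = 0 := by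
  let r : E → E := fun x => (max 1 ‖x‖)⁻¹ • x
  let c : E → ℝ := fun x => max 0 (2 - max 1 ‖x‖)
  have hm (x : E) : 0 < max 1 ‖x‖ := lt_max_of_lt_left one_pos
  have hr : Continuous r :=
    ((continuous_const.max continuous_norm).inv₀ fun x => (hm x).ne').smul continuous_id
  have hrB (x : E) : r x ∈ closedBall (0 : E) 1 := by
    rw [mem_closedBall_zero_iff, norm_smul, norm_inv, Real.norm_of_nonneg (hm x).le,
      inv_mul_le_one₀ (hm x)]
    exact le_max_right _ _
  have hrid (x : E) (hx : ‖x‖ ≤ 1) : r x = x := by simp [r, max_eq_left hx]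
  let k : E → E := fun x => x + c x • (h (r x) - r x)
  have hk : Continuous k := by
    refine continuous_id.add (Continuous.smul (by fun_prop) (Continuous.sub ?_ hr))
    exact hc.comp_continuous hr hrB
  obtain ⟨x, hx⟩ := hk.exists_eq_zero_of_eq_id_far (R := 2) two_pos fun x hx => by
    have : c x = 0 := max_eq_left (by linarith [le_max_right 1 ‖x‖])
    simp [k, this]
  have hx1 : ‖x‖ ≤ 1 := by
    by_contra! hlt
    have hcx : c x < 1 := max_lt one_pos (by linarith [le_max_right 1 ‖x‖])
    have hxe : ‖x‖ = ‖c x • (h (r x) - r x)‖ := by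
      exact (congrArg (‖·‖) (eq_neg_of_add_eq_zero_left hx)).trans (norm_neg _)
    rw [norm_smul, Real.norm_of_nonneg (le_max_left _ _)] at hxe
    have := mul_le_of_le_one_right (le_max_left 0 (2 - max 1 ‖x‖)) (hh _ (hrB x))
    linarith
  refine ⟨x, by simpa using hx1, ?_⟩
  have hcx : c x = 1 := by simp [c, max_eq_left hx1]; norm_num
  simpa [k, hcx, hrid x hx1] using hx

/-- If a continuous map `f` on the closed unit ball has a continuous left inverse `G` which is small
on a ball around `0` containing `f 0`, then `f` has a zero. -/
theorem ContinuousOn.exists_eq_zero_of_leftInvOn {f G : E → E} {ε : ℝ}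
    (hf : ContinuousOn f (closedBall 0 1)) (hG : Continuous G)
    (hGf : LeftInvOn G f (closedBall 0 1)) (hf0 : ‖f 0‖ < ε)
    (hGε : ∀ y, ‖y‖ ≤ ε → ‖G y‖ ≤ 1 / 10) : ∃ x ∈ closedBall (0 : E) 1, f x = 0 := by
  by_contra! hne
  borelize E
  have hε : 0 < ε := (norm_nonneg _).trans_lt hf0
  have h0B : (0 : E) ∈ closedBall (0 : E) 1 := by simp
  have hK : IsCompact (f '' closedBall 0 1 ∩ {y | ε ≤ ‖y‖}) :=
    ((isCompact_closedBall 0 1).image_of_continuousOn hf).inter_right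
      (isClosed_le continuous_const continuous_norm)
  obtain ⟨δ₁, hδ₁, hδ₁G⟩ := hK.exists_forall_le' (a := (0 : ℝ)) hG.norm.continuousOn (by
    rintro _ ⟨⟨x, hx, rfl⟩, hxε⟩
    rw [hGf hx, norm_pos_iff]
    rintro rfl
    exact hf0.not_ge hxε)
  let δ := min δ₁ (1 / 10)
  have hδ : 0 < δ := lt_min hδ₁ (by norm_num)
  obtain ⟨P, hP, hPG, -⟩ := hG.exists_contDiff_approx 1 (ε := fun _ => δ / 2) continuous_const
    fun _ => half_pos hδ
  obtain ⟨w, hw, hwP⟩ : ∃ w ∈ ball (0 : E) (δ / 2), w ∉ P '' sphere 0 ε := by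
    by_contra! hsub
    have h0 : (volume : Measure E) (P '' sphere 0 ε) = 0 :=
      addHaar_image_eq_zero_of_differentiableOn_of_addHaar_eq_zero _
        (hP.differentiable one_ne_zero).differentiableOn
        (Measure.addHaar_sphere_of_ne_zero _ _ hε.ne')
    exact (measure_ball_pos volume (0 : E) (half_pos hδ)).ne' (measure_mono_null hsub h0)
  have hQ (y : E) : ‖(P y - w) - G y‖ < δ := by
    have h1 : ‖P y - G y‖ < δ / 2 := by simpa [dist_eq_norm] using hPG y
    have h2 : ‖w‖ < δ / 2 := by simpa using hw
    calc ‖(P y - w) - G y‖ = ‖(P y - G y) - w‖ := by rw [sub_right_comm]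
      _ ≤ ‖P y - G y‖ + ‖w‖ := norm_sub_le _ _
      _ < δ := by linarith
  let Φ : E → E := fun y => (max ε ‖y‖ * ‖y‖⁻¹) • y
  have hΦfar (y : E) (hy0 : y ≠ 0) (hy : ε ≤ ‖y‖) : Φ y = y := by
    simp [Φ, max_eq_right hy, hy0]
  have hΦnear (y : E) (hy0 : y ≠ 0) (hy : ‖y‖ ≤ ε) : ‖Φ y‖ = ε := by
    simp [Φ, max_eq_left hy, norm_smul, hy0, abs_of_pos hε]
  have hcont : ContinuousOn (fun x => P (Φ (f x)) - w) (closedBall 0 1) := by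
    refine (hP.continuous.comp_continuousOn ?_).sub continuousOn_const
    exact ((ContinuousOn.sup continuousOn_const hf.norm).mul
      (hf.norm.inv₀ fun x hx => norm_ne_zero_iff.2 (hne x hx))).smul hf
  have hδ10 : δ ≤ 1 / 10 := min_le_right _ _
  obtain ⟨x, hx, hx0⟩ := hcont.exists_eq_zero_of_norm_sub_le_one fun x hx => by
    rcases le_total ε ‖f x‖ with h | h
    · rw [hΦfar _ (hne x hx) h]
      nth_rw 2 [← hGf hx]
      linarith [hQ (f x)]
    · have h1 := hQ (Φ (f x))
      have h2 := hGε (Φ (f x)) (hΦnear _ (hne x hx) h).le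
      have h3 := hGε _ h
      rw [hGf hx] at h3
      calc ‖P (Φ (f x)) - w - x‖
          = ‖(P (Φ (f x)) - w - G (Φ (f x))) + G (Φ (f x)) - x‖ := by rw [sub_add_cancel]
        _ ≤ ‖P (Φ (f x)) - w - G (Φ (f x))‖ + ‖G (Φ (f x))‖ + ‖x‖ :=
          (norm_sub_le _ _).trans (add_le_add_left (norm_add_le _ _) _)
        _ ≤ 1 := by linarith
  rcases le_total ε ‖f x‖ with h | h
  · rw [hΦfar _ (hne x hx) h] at hx0
    have h1 := hQ (f x)
    rw [hx0, zero_sub, norm_neg] at h1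
    have h2 := hδ₁G (f x) ⟨mem_image_of_mem _ hx, h⟩
    linarith [min_le_left δ₁ (1 / 10)]
  · exact hwP ⟨Φ (f x), by simpa using hΦnear _ (hne x hx) h, sub_eq_zero.1 hx0⟩

theorem ContinuousOn.image_closedBall_mem_nhds_of_injOn {f : E → E}
    (hf : ContinuousOn f (closedBall 0 1)) (hinj : InjOn f (closedBall 0 1)) :
    f '' closedBall 0 1 ∈ 𝓝 (f 0) := by
  have : CompactSpace (closedBall (0 : E) 1) :=
    isCompact_iff_compactSpace.1 (isCompact_closedBall 0 1)
  have h0B : (0 : E) ∈ closedBall (0 : E) 1 := by simp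
  have hemb : Topology.IsClosedEmbedding ((closedBall (0 : E) 1).domRestrict f) :=
    (continuousOn_iff_continuous_domRestrict.1 hf).isClosedEmbedding hinj.injective
  obtain ⟨G, hG⟩ := ContinuousMap.exists_extension' hemb
    (⟨Subtype.val, continuous_subtype_val⟩ : C(closedBall (0 : E) 1, E))
  have hGf : LeftInvOn G f (closedBall 0 1) := fun x hx => congrFun hG ⟨x, hx⟩
  have hG0 : G (f 0) = 0 := hGf h0B
  obtain ⟨ε, hε, hGε⟩ := Metric.continuousAt_iff.1 (G.continuous.continuousAt (x := f 0)) (1 / 10)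
    (by norm_num)
  refine Filter.mem_of_superset (ball_mem_nhds (f 0) (half_pos hε)) fun c hc => ?_
  obtain ⟨x, hx, hxc⟩ := ContinuousOn.exists_eq_zero_of_leftInvOn (f := fun x => f x - c)
    (G := fun y => G (y + c)) (ε := ε / 2) (hf.sub continuousOn_const) (by fun_prop)
    (fun x hx => by simpa using hGf hx)
    (by rwa [← dist_eq_norm, dist_comm])
    (fun y hy => by
      have h1 : dist (y + c) (f 0) < ε := by
        calc dist (y + c) (f 0) ≤ dist (y + c) c + dist c (f 0) := dist_triangle _ _ _
          _ < ε := by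
            have : dist c (f 0) < ε / 2 := hc
            rw [dist_eq_norm, add_sub_cancel_right]
            linarith
      simpa [hG0] using (hGε h1).le)
  exact ⟨x, hx, sub_eq_zero.1 hxc⟩

/-- **Invariance of domain** for Euclidean spaces. -/
theorem ContinuousOn.image_mem_nhds_of_injOn_euclidean {f : E → E} {U : Set E} (hU : IsOpen U)
    (hf : ContinuousOn f U) (hinj : InjOn f U) {x : E} (hx : x ∈ U) : f '' U ∈ 𝓝 (f x) := by
  obtain ⟨r, hr, hrU⟩ := Metric.nhds_basis_closedBall.mem_iff.1 (hU.mem_nhds hx)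
  have hmaps : MapsTo (fun y => x + r • y) (closedBall (0 : E) 1) U := fun y hy => hrU (by
    have hy' : ‖y‖ ≤ 1 := by simpa using hy
    simpa [norm_smul, abs_of_pos hr] using mul_le_of_le_one_right hr.le hy')
  have haff : Function.Injective fun y : E => x + r • y :=
    (add_right_injective x).comp (smul_right_injective E hr.ne')
  have h := ContinuousOn.image_closedBall_mem_nhds_of_injOn
    (hf.comp (by fun_prop : Continuous fun y : E => x + r • y).continuousOn hmaps)
    (hinj.comp haff.injOn hmaps)
  simp only [Function.comp_apply, smul_zero, add_zero] at h
  refine Filter.mem_of_superset h ?_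
  rintro _ ⟨y, hy, rfl⟩
  exact mem_image_of_mem f (hmaps hy)

end InvarianceOfDomain

/-- **Invariance of domain** for finite-dimensional normed spaces. -/
theorem ContinuousOn.image_mem_nhds_of_injOn {F : Type*} [NormedAddCommGroup F] [NormedSpace ℝ F]
    [FiniteDimensional ℝ F] {f : F → F} {U : Set F} (hU : IsOpen U)
    (hf : ContinuousOn f U) (hinj : InjOn f U) {x : F} (hx : x ∈ U) : f '' U ∈ 𝓝 (f x) := by
  let e : F ≃L[ℝ] EuclideanSpace ℝ (Fin (finrank ℝ F)) := toEuclidean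
  have hmaps : MapsTo e.symm (e.symm ⁻¹' U) U := mapsTo_preimage _ _
  have h := ContinuousOn.image_mem_nhds_of_injOn_euclidean (f := e ∘ f ∘ e.symm)
    (hU.preimage e.symm.continuous)
    (e.continuous.comp_continuousOn (hf.comp e.symm.continuous.continuousOn hmaps))
    (e.injective.comp_injOn (hinj.comp e.symm.injective.injOn hmaps))
    (x := e x) (by simpa using hx)
  have him : (e ∘ f ∘ e.symm) '' (e.symm ⁻¹' U) = e '' (f '' U) := by
    rw [image_comp, image_comp, image_preimage_eq _ e.symm.surjective]
  rw [him] at h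
  have h' := e.continuous.continuousAt.preimage_mem_nhds (x := f x) (by simpa using h)
  rwa [preimage_image_eq _ e.injective] at h'

/-- If `ψ : Ω × S → N` is continuous, each `ψ p` is injective, and `ψ p s₀ = p`
on an open set `Ω` of a topological manifold `N`, where `S` is a manifold of the
same dimension, then every `p₀ ∈ Ω` has an open neighborhood `U ⊆ Ω` with
`U ⊆ ψ q '' S` for all `q ∈ U`. -/
theorem uniform_covering_of_injective_family
    {n : ℕ} {N S : Type*}
    [TopologicalSpace N] [T2Space N] [ChartedSpace (EuclideanSpace ℝ (Fin n)) N]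
    [TopologicalSpace S] [T2Space S] [ChartedSpace (EuclideanSpace ℝ (Fin n)) S]
    (Ω : Set N) (hΩ : IsOpen Ω)
    (ψ : N → S → N)
    (hcont : ContinuousOn (fun x : N × S => ψ x.1 x.2) (Ω ×ˢ (Set.univ : Set S)))
    (hinj : ∀ p ∈ Ω, Function.Injective (ψ p))
    (s₀ : S) (hs₀ : ∀ p ∈ Ω, ψ p s₀ = p)
    (p₀ : N) (hp₀ : p₀ ∈ Ω) :
    ∃ U : Set N, IsOpen U ∧ p₀ ∈ U ∧ U ⊆ Ω ∧
      ∀ q ∈ U, U ⊆ Set.range (ψ q) := by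
  let φ := chartAt (EuclideanSpace ℝ (Fin n)) p₀
  let χ := chartAt (EuclideanSpace ℝ (Fin n)) s₀
  have hp₀φ : p₀ ∈ φ.source := mem_chart_source _ p₀
  have hs₀χ : s₀ ∈ χ.source := mem_chart_source _ s₀
  let Ψ : N × S → N × N := fun z => (z.1, ψ z.1 z.2)
  have hΨ : ContinuousOn Ψ (Ω ×ˢ univ) := continuousOn_fst.prodMk hcont
  have hΨinj : InjOn Ψ (Ω ×ˢ univ) := by
    rintro ⟨p, s⟩ hp ⟨q, t⟩ - h
    obtain ⟨rfl, h⟩ := Prod.mk.inj h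
    exact congrArg (Prod.mk p) (hinj p hp.1 h)
  let A := φ.prod χ
  let B := φ.prod φ
  have hΨV : IsOpen ((Ω ×ˢ univ) ∩ Ψ ⁻¹' B.source) :=
    hΨ.isOpen_inter_preimage (hΩ.prod isOpen_univ) B.open_source
  have hV : IsOpen (A.target ∩ A.symm ⁻¹' ((Ω ×ˢ univ) ∩ Ψ ⁻¹' B.source)) :=
    A.isOpen_inter_preimage_symm hΨV
  have hz₀ : A (p₀, s₀) ∈ A.target ∩ A.symm ⁻¹' ((Ω ×ˢ univ) ∩ Ψ ⁻¹' B.source) := by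
    have hzA : (p₀, s₀) ∈ A.source := ⟨hp₀φ, hs₀χ⟩
    refine ⟨A.map_source hzA, ?_⟩
    rw [mem_preimage, A.left_inv hzA]
    exact ⟨⟨hp₀, trivial⟩, hp₀φ, show ψ p₀ s₀ ∈ φ.source by rwa [hs₀ p₀ hp₀]⟩
  have key := ContinuousOn.image_mem_nhds_of_injOn (f := B ∘ Ψ ∘ A.symm) hV
    (B.continuousOn.comp (hΨ.comp (A.continuousOn_symm.mono inter_subset_left)
      fun z hz => hz.2.1) fun z hz => hz.2.2)
    (B.injOn.comp (hΨinj.comp (A.symm.injOn.mono inter_subset_left)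
      fun z hz => hz.2.1) fun z hz => hz.2.2) hz₀
  have hval : (B ∘ Ψ ∘ A.symm) (A (p₀, s₀)) = B (p₀, p₀) := by
    have hzA : (p₀, s₀) ∈ A.source := ⟨hp₀φ, hs₀χ⟩
    simp only [Function.comp_apply, A.left_inv hzA, Ψ, hs₀ p₀ hp₀]
  rw [hval] at key
  have hzB : (p₀, p₀) ∈ B.source := ⟨hp₀φ, hp₀φ⟩
  have hnhds : B.source ∩ B ⁻¹' ((B ∘ Ψ ∘ A.symm) ''
      (A.target ∩ A.symm ⁻¹' ((Ω ×ˢ univ) ∩ Ψ ⁻¹' B.source))) ∈ 𝓝 (p₀, p₀) :=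
    Filter.inter_mem (B.open_source.mem_nhds hzB) ((B.continuousAt hzB).preimage_mem_nhds key)
  obtain ⟨W₁, W₂, hW₁, hpW₁, hW₂, hpW₂, hWsub⟩ := mem_nhds_prod_iff'.1 hnhds
  refine ⟨W₁ ∩ W₂ ∩ Ω, (hW₁.inter hW₂).inter hΩ, ⟨⟨hpW₁, hpW₂⟩, hp₀⟩, inter_subset_right,
    fun q hq y hy => ?_⟩
  obtain ⟨hqy, z, hz, hzqy⟩ := hWsub (mk_mem_prod hq.1.1 hy.1.2)
  have h := B.injOn hz.2.2 hqy hzqy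
  obtain ⟨h1, h2⟩ := Prod.mk.inj h
  exact ⟨(A.symm z).2, by rw [← h1]; exact h2⟩
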